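/- Let p be a prime number with p ≡ 2 (mod 9) or p ≡ 5 (mod 9). Then the set 𝓕 = {f_ℓ : ℓ ∈ ℕ} ∪ {g_ℓ : ℓ ∈ ℕ} ∪ {x − 1, x, x + 1} ⊆ 𝔽_p[x] is infinite and is a proper subset of the set of all monic irreducible polynomials in 𝔽_p[x]. -/

import Mathlib

open Polynomial

theorem exists_pow_two_mul_three_pow_eq {p : ℕ} (hmod : p % 9 = 2 ∨ p % 9 = 5) (j : ℕ) :
    ∃ k, p ^ (2 * 3 ^ j) = 1 + 3 ^ (j + 1) * k ∧ ¬ 3 ∣ k := by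
  induction j with
  | zero =>
    have hp := Nat.div_add_mod p 9
    generalize p / 9 = m at hp
    rcases hmod with h | h <;> rw [h] at hp
    · exact ⟨27 * m ^ 2 + 12 * m + 1, by rw [← hp]; ring, by omega⟩
    · exact ⟨27 * m ^ 2 + 30 * m + 8, by rw [← hp]; ring, by omega⟩
  | succ j ih =>
    obtain ⟨k, hk, h3⟩ := ih
    refine ⟨k + 3 * (3 ^ j * k ^ 2 + 3 ^ j * 3 ^ j * k ^ 3), ?_, by omega⟩
    rw [pow_succ 3 j, ← mul_assoc, pow_mul, hk]
    ring

theorem orderOf_unitOfCoprime_three_pow {p : ℕ} (hmod : p % 9 = 2 ∨ p % 9 = 5) (l : ℕ)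
    (h : p.Coprime (3 ^ (l + 1))) : orderOf (ZMod.unitOfCoprime p h) = 2 * 3 ^ l := by
  have pow_eq_one_iff (n : ℕ) :
      ZMod.unitOfCoprime p h ^ n = 1 ↔ p ^ n ≡ 1 [MOD 3 ^ (l + 1)] := by
    rw [← ZMod.natCast_eq_natCast_iff, Units.ext_iff]
    simp
  refine orderOf_eq_of_pow_and_pow_div_prime (by positivity) ?_ fun q hq hdvd ↦ ?_
  · obtain ⟨k, hk, -⟩ := exists_pow_two_mul_three_pow_eq hmod l
    rw [pow_eq_one_iff, hk]
    simp [Nat.ModEq]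
  · rw [Ne, pow_eq_one_iff]
    intro hone
    rcases hq.dvd_mul.mp hdvd with h2 | h3
    · obtain rfl := (Nat.prime_dvd_prime_iff_eq hq Nat.prime_two).mp h2
      rw [Nat.mul_div_cancel_left _ two_pos] at hone
      have hone : p ^ 3 ^ l ≡ 1 [MOD 3] := hone.of_dvd (dvd_pow_self 3 l.succ_ne_zero)
      have hneg : (p : ZMod 3) = -1 := by
        have : p ≡ 2 [MOD 3] := by unfold Nat.ModEq; omega
        exact (ZMod.natCast_eq_natCast_iff _ _ _).mpr this
      rw [← ZMod.natCast_eq_natCast_iff, Nat.cast_pow, hneg,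
        (Odd.pow (by decide : Odd 3)).neg_one_pow] at hone
      exact absurd hone (by decide)
    · obtain rfl := (Nat.prime_dvd_prime_iff_eq hq Nat.prime_three).mp (hq.dvd_of_dvd_pow h3)
      cases l with
      | zero => simp at h3
      | succ j =>
        obtain ⟨k, hk, hk3⟩ := exists_pow_two_mul_three_pow_eq hmod j
        rw [pow_succ 3 j, ← mul_assoc, Nat.mul_div_cancel _ three_pos, hk] at hone
        have hdvd := (Nat.modEq_iff_dvd' (by omega)).mp hone.symm
        rw [Nat.add_sub_cancel_left, pow_succ] at hdvd
        exact hk3 (Nat.dvd_of_mul_dvd_mul_left (by positivity) hdvd)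

theorem cyclotomic_three_pow (R : Type*) [CommRing R] (l : ℕ) :
    cyclotomic (3 ^ (l + 1)) R = X ^ (2 * 3 ^ l) + X ^ (3 ^ l) + 1 := by
  rw [cyclotomic_prime_pow_eq_geom_sum Nat.prime_three]
  simp only [Finset.sum_range_succ, Finset.sum_range_zero]
  ring

theorem natDegree_cyclotomic_three_pow (R : Type*) [CommRing R] [Nontrivial R] (l : ℕ) :
    (cyclotomic (3 ^ (l + 1)) R).natDegree = 2 * 3 ^ l := by
  rw [natDegree_cyclotomic, Nat.totient_prime_pow_succ Nat.prime_three, mul_comm]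

theorem irreducible_cyclotomic_three_pow {p : ℕ} [Fact p.Prime]
    (hmod : p % 9 = 2 ∨ p % 9 = 5) (l : ℕ) :
    Irreducible (cyclotomic (3 ^ (l + 1)) (ZMod p)) := by
  have hp3 : ¬ p ∣ 3 ^ (l + 1) := fun h ↦ by
    have := (Nat.prime_dvd_prime_iff_eq Fact.out Nat.prime_three).mp
      ((Fact.out : p.Prime).dvd_of_dvd_pow h)
    omega
  refine ZMod.irreducible_of_dvd_cyclotomic_of_natDegree hp3 dvd_rfl ?_
  rw [natDegree_cyclotomic_three_pow, orderOf_unitOfCoprime_three_pow hmod]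

theorem cyclotomic_three_pow_comp_neg_X (R : Type*) [CommRing R] (l : ℕ) :
    (cyclotomic (3 ^ (l + 1)) R).comp (-X) = X ^ (2 * 3 ^ l) - X ^ (3 ^ l) + 1 := by
  have hodd : Odd (3 ^ l) := Odd.pow (by decide)
  simp [cyclotomic_three_pow, hodd.neg_pow, (even_two_mul (3 ^ l)).neg_pow, sub_eq_add_neg]

theorem exists_monic_irreducible_natDegree_eq (p : ℕ) [Fact p.Prime] {n : ℕ} (hn : n ≠ 0) :
    ∃ P : (ZMod p)[X], P.Monic ∧ Irreducible P ∧ P.natDegree = n := by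
  obtain ⟨a, ha⟩ := Field.exists_primitive_element (ZMod p) (GaloisField p n)
  have hint : IsIntegral (ZMod p) a := Algebra.IsIntegral.isIntegral a
  refine ⟨minpoly (ZMod p) a, minpoly.monic hint, minpoly.irreducible hint, ?_⟩
  rw [(Field.primitive_element_iff_minpoly_natDegree_eq _ a).mp ha, GaloisField.finrank p hn]

theorem stmt_11 (p : ℕ) (hp : p.Prime) (hmod : p % 9 = 2 ∨ p % 9 = 5) :
    let 𝓕 : Set (Polynomial (ZMod p)) :=
      {P | ∃ ℓ : ℕ, P = X ^ (2 * 3 ^ ℓ) + X ^ (3 ^ ℓ) + 1} ∪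
      {P | ∃ ℓ : ℕ, P = X ^ (2 * 3 ^ ℓ) - X ^ (3 ^ ℓ) + 1} ∪
      {X - 1, X, X + 1}
    𝓕.Infinite ∧ 𝓕 ⊂ {P : Polynomial (ZMod p) | P.Monic ∧ Irreducible P} := by
  intro 𝓕
  have : Fact p.Prime := ⟨hp⟩
  have natDegree_comp_neg (l : ℕ) :
      ((cyclotomic (3 ^ (l + 1)) (ZMod p)).comp (-X)).natDegree = 2 * 3 ^ l := by
    rw [natDegree_comp, natDegree_neg, natDegree_X, mul_one, natDegree_cyclotomic_three_pow]
  refine ⟨Set.infinite_of_injective_forall_mem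
    (f := fun l : ℕ ↦ cyclotomic (3 ^ (l + 1)) (ZMod p)) (fun a b hab ↦ ?_)
    fun l ↦ .inl (.inl ⟨l, cyclotomic_three_pow _ l⟩), ?_⟩
  · have := congrArg natDegree hab
    simpa [natDegree_cyclotomic_three_pow] using this
  rw [Set.ssubset_iff_exists]
  constructor
  · rintro P ((⟨l, rfl⟩ | ⟨l, rfl⟩) | rfl | rfl | rfl)
    · rw [← cyclotomic_three_pow]
      exact ⟨cyclotomic.monic _ _, irreducible_cyclotomic_three_pow hmod l⟩
    · constructor
      · monicity!
      · rw [← cyclotomic_three_pow_comp_neg_X]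
        exact (MulEquiv.irreducible_iff (algEquivAevalNegX (R := ZMod p))).mpr
          (irreducible_cyclotomic_three_pow hmod l)
    · exact ⟨monic_X_sub_C 1, irreducible_X_sub_C 1⟩
    · exact ⟨monic_X, irreducible_X⟩
    · exact ⟨monic_X_add_C 1, (monic_X_add_C 1).irreducible_of_degree_eq_one (degree_X_add_C 1)⟩
  · obtain ⟨P, hmonic, hirr, hdeg⟩ := exists_monic_irreducible_natDegree_eq p three_ne_zero
    refine ⟨P, ⟨hmonic, hirr⟩, ?_⟩
    rintro ((⟨l, rfl⟩ | ⟨l, rfl⟩) | rfl | rfl | rfl)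
    · rw [← cyclotomic_three_pow, natDegree_cyclotomic_three_pow] at hdeg
      omega
    · rw [← cyclotomic_three_pow_comp_neg_X, natDegree_comp_neg] at hdeg
      omega
    · simpa using (natDegree_X_sub_C (1 : ZMod p)).symm.trans hdeg
    · simp at hdeg
    · simpa using (natDegree_X_add_C (1 : ZMod p)).symm.trans hdeg
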